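/- For every finite bipartite graph G=(A,B,E), |ker(G)| + |diadem(G)| = 2α(G). -/

import Mathlib

open Finset

open scoped Classical

variable {V : Type*} [Fintype V] [DecidableEq V]

/-- The neighborhood `N(X)` of a finite set of vertices `X`. -/
noncomputable def nbr (G : SimpleGraph V) (X : Finset V) : Finset V :=
  Finset.univ.filter fun v => ∃ x ∈ X, G.Adj v x

/-- The difference `d(X) = |X| - |N(X)|` of a set of vertices. -/
noncomputable def diffZ (G : SimpleGraph V) (X : Finset V) : ℤ :=
  (X.card : ℤ) - ((nbr G X).card : ℤ)

/-- The critical difference `d_c(G) = max {d(X) : X ⊆ V}`. -/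
noncomputable def critDiff (G : SimpleGraph V) : ℤ :=
  (Finset.univ : Finset V).powerset.sup' (Finset.powerset_nonempty _) (diffZ G)

/-- A set of vertices is independent if no two of its vertices are adjacent. -/
def IsIndep (G : SimpleGraph V) (S : Finset V) : Prop :=
  ∀ u ∈ S, ∀ v ∈ S, ¬ G.Adj u v

/-- The independence number `α(G)`. -/
noncomputable def indepNum (G : SimpleGraph V) : ℕ :=
  ((Finset.univ : Finset V).powerset.filter (IsIndep G)).sup Finset.card

/-- The critical independence difference `id_c(G) = max {d(I) : I independent}`. -/
noncomputable def idc (G : SimpleGraph V) : ℤ :=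
  ((Finset.univ : Finset V).powerset.filter (IsIndep G)).sup'
    ⟨∅, by simp [IsIndep]⟩ (diffZ G)

/-- A critical independent set: an independent set `S` with `d(S) = id_c(G)`. -/
def CritIndep (G : SimpleGraph V) (S : Finset V) : Prop :=
  IsIndep G S ∧ diffZ G S = idc G

/-- A finite set of edges of `G` that are pairwise non-incident (a matching). -/
def IsMatchingSet (G : SimpleGraph V) (M : Finset (Sym2 V)) : Prop :=
  (∀ e ∈ M, e ∈ G.edgeSet) ∧
    (M : Set (Sym2 V)).Pairwise fun e f => ∀ v : V, ¬(v ∈ e ∧ v ∈ f)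

/-- The matching number `μ(G)`. -/
noncomputable def matchNum (G : SimpleGraph V) : ℕ :=
  ((Finset.univ : Finset (Sym2 V)).powerset.filter (IsMatchingSet G)).sup Finset.card

/-- A maximum independent set. -/
def IsMaxIndep (G : SimpleGraph V) (S : Finset V) : Prop :=
  IsIndep G S ∧ S.card = indepNum G

/-- `ker(G)`: the intersection of all critical independent sets. -/
noncomputable def kerSet (G : SimpleGraph V) : Finset V :=
  Finset.univ.filter fun v => ∀ S : Finset V, CritIndep G S → v ∈ S

/-- `diadem(G)`: the union of all critical independent sets. -/
noncomputable def diademSet (G : SimpleGraph V) : Finset V :=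
  Finset.univ.filter fun v => ∃ S : Finset V, CritIndep G S ∧ v ∈ S

/-- `core(G)`: the intersection of all maximum independent sets. -/
noncomputable def coreSet (G : SimpleGraph V) : Finset V :=
  Finset.univ.filter fun v => ∀ S : Finset V, IsMaxIndep G S → v ∈ S

/-- `corona(G)`: the union of all maximum independent sets. -/
noncomputable def coronaSet (G : SimpleGraph V) : Finset V :=
  Finset.univ.filter fun v => ∃ S : Finset V, IsMaxIndep G S ∧ v ∈ S

/-- `δ₀(A) = max {δ(X) : X ⊆ A}`, the maximum deficiency over subsets of a side. -/
noncomputable def delta0 (G : SimpleGraph V) (A : Finset V) : ℤ :=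
  A.powerset.sup' (Finset.powerset_nonempty _) (diffZ G)

/-- An `A`-critical set: a subset `X ⊆ A` with `δ(X) = δ₀(A)`. -/
def SideCrit (G : SimpleGraph V) (A X : Finset V) : Prop :=
  X ⊆ A ∧ diffZ G X = delta0 G A

/-- `ker_A(G)`: the intersection of all `A`-critical sets. -/
noncomputable def kerSide (G : SimpleGraph V) (A : Finset V) : Finset V :=
  Finset.univ.filter fun v => ∀ X : Finset V, SideCrit G A X → v ∈ X

/-- `diadem_A(G)`: the union of all `A`-critical sets. -/
noncomputable def diademSide (G : SimpleGraph V) (A : Finset V) : Finset V :=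
  Finset.univ.filter fun v => ∃ X : Finset V, SideCrit G A X ∧ v ∈ X

/-- `{A, B}` is a bipartition of `G`: both sides nonempty, disjoint, covering all
vertices, and every edge goes between `A` and `B`. -/
def IsBipartition (G : SimpleGraph V) (A B : Finset V) : Prop :=
  A.Nonempty ∧ B.Nonempty ∧ Disjoint A B ∧ A ∪ B = Finset.univ ∧
    ∀ u v : V, G.Adj u v → (u ∈ A ∧ v ∈ B) ∨ (u ∈ B ∧ v ∈ A)

theorem mem_nbr {G : SimpleGraph V} {X : Finset V} {v : V} :
    v ∈ nbr G X ↔ ∃ x ∈ X, G.Adj v x := by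
  simp [nbr]

theorem nbr_union (G : SimpleGraph V) (X Y : Finset V) :
    nbr G (X ∪ Y) = nbr G X ∪ nbr G Y := by
  ext v
  simp only [mem_nbr, mem_union]
  grind

theorem nbr_inter_subset (G : SimpleGraph V) (X Y : Finset V) :
    nbr G (X ∩ Y) ⊆ nbr G X ∩ nbr G Y := by
  intro v
  simp only [mem_nbr, mem_inter]
  grind

/-- The difference function is supermodular. -/
theorem diffZ_add_le (G : SimpleGraph V) (X Y : Finset V) :
    diffZ G X + diffZ G Y ≤ diffZ G (X ∩ Y) + diffZ G (X ∪ Y) := by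
  have h₁ := card_union_add_card_inter X Y
  have h₂ := card_union_add_card_inter (nbr G X) (nbr G Y)
  have h₃ := card_le_card (nbr_inter_subset G X Y)
  simp only [diffZ, nbr_union]
  omega

theorem diffZ_le_delta0 (G : SimpleGraph V) {A X : Finset V} (hX : X ⊆ A) :
    diffZ G X ≤ delta0 G A :=
  le_sup' (diffZ G) (mem_powerset.2 hX)

theorem exists_sideCrit (G : SimpleGraph V) (A : Finset V) : ∃ X, SideCrit G A X := by
  obtain ⟨X, hX, h⟩ := exists_mem_eq_sup' (powerset_nonempty A) (diffZ G)
  exact ⟨X, mem_powerset.1 hX, h.symm⟩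

theorem SideCrit.inter {G : SimpleGraph V} {A X Y : Finset V} (hX : SideCrit G A X)
    (hY : SideCrit G A Y) : SideCrit G A (X ∩ Y) := by
  have hi : X ∩ Y ⊆ A := inter_subset_left.trans hX.1
  have h₁ := diffZ_le_delta0 G hi
  have h₂ := diffZ_le_delta0 G (union_subset hX.1 hY.1)
  have h₃ := diffZ_add_le G X Y
  have h₄ := hX.2
  have h₅ := hY.2
  exact ⟨hi, by omega⟩

theorem sideCrit_kerSide (G : SimpleGraph V) (A : Finset V) :
    SideCrit G A (kerSide G A) := by
  obtain ⟨K, hK, hmin⟩ := exists_min_image (univ.filter (SideCrit G A)) card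
    ((exists_sideCrit G A).imp fun X hX => by simpa using hX)
  simp only [mem_filter, mem_univ, true_and] at hK hmin
  have hle : ∀ Y, SideCrit G A Y → K ⊆ Y := fun Y hY =>
    inter_eq_left.1 (eq_of_subset_of_card_le inter_subset_left (hmin _ (hK.inter hY)))
  have : kerSide G A = K := by
    ext v
    simp only [kerSide, mem_filter, mem_univ, true_and]
    exact ⟨fun h => h K hK, fun h Y hY => hle Y hY h⟩
  rwa [this]

section Bipartite

variable {G : SimpleGraph V} {A B X Y S : Finset V}

theorem IsBipartition.symm (h : IsBipartition G A B) : IsBipartition G B A :=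
  ⟨h.2.1, h.1, h.2.2.1.symm, by rw [union_comm, h.2.2.2.1], fun u v huv =>
    (h.2.2.2.2 u v huv).symm⟩

theorem IsBipartition.mem_right_iff (h : IsBipartition G A B) {v : V} : v ∈ B ↔ v ∉ A := by
  have h₁ : v ∈ A ∪ B := by rw [h.2.2.2.1]; exact mem_univ v
  have h₂ : v ∈ A → v ∉ B := fun hv => disjoint_left.1 h.2.2.1 hv
  rw [mem_union] at h₁
  tauto

theorem IsBipartition.mem_right_of_adj (h : IsBipartition G A B) {u v : V} (huv : G.Adj u v)
    (hv : v ∈ A) : u ∈ B := by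
  have := h.2.2.2.2 u v huv
  have := h.mem_right_iff (v := v)
  tauto

theorem IsBipartition.nbr_subset (h : IsBipartition G A B) (hX : X ⊆ A) : nbr G X ⊆ B := by
  intro v hv
  obtain ⟨x, hx, hvx⟩ := mem_nbr.1 hv
  exact h.mem_right_of_adj hvx (hX hx)

theorem IsBipartition.card_inter_add_card_inter (h : IsBipartition G A B) (S : Finset V) :
    (S ∩ A).card + (S ∩ B).card = S.card := by
  rw [← card_union_of_disjoint (h.2.2.1.mono inter_subset_right inter_subset_right),
    ← inter_union_distrib_left, h.2.2.2.1, inter_univ]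

theorem IsBipartition.diffZ_eq (h : IsBipartition G A B) (S : Finset V) :
    diffZ G S = diffZ G (S ∩ A) + diffZ G (S ∩ B) := by
  have hS : nbr G S = nbr G (S ∩ A) ∪ nbr G (S ∩ B) := by
    rw [← nbr_union, ← inter_union_distrib_left, h.2.2.2.1, inter_univ]
  have hd : Disjoint (nbr G (S ∩ A)) (nbr G (S ∩ B)) :=
    h.2.2.1.symm.mono (h.nbr_subset inter_subset_right) (h.symm.nbr_subset inter_subset_right)
  have hc := h.card_inter_add_card_inter S
  simp only [diffZ, hS, card_union_of_disjoint hd]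
  omega

theorem IsBipartition.isIndep_union_sdiff_nbr (h : IsBipartition G A B) (hX : X ⊆ A) :
    IsIndep G (X ∪ (B \ nbr G X)) := by
  intro u hu v hv huv
  have h₁ := h.mem_right_iff (v := u)
  have h₂ := h.mem_right_iff (v := v)
  have h₃ := h.2.2.2.2 u v huv
  simp only [mem_union, mem_sdiff, mem_nbr] at hu hv
  have := huv.symm
  grind

theorem IsBipartition.card_union_sdiff_nbr (h : IsBipartition G A B) (hX : X ⊆ A) :
    ((X ∪ (B \ nbr G X)).card : ℤ) = B.card + diffZ G X := by
  rw [card_union_of_disjoint (h.2.2.1.mono hX sdiff_subset)]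
  have := card_sdiff_add_card_eq_card (h.nbr_subset hX)
  simp only [diffZ]
  omega

theorem IsIndep.card_le_indepNum (hS : IsIndep G S) : S.card ≤ indepNum G :=
  le_sup (f := card) (by simpa using hS)

theorem IsBipartition.indepNum_eq (h : IsBipartition G A B) :
    (indepNum G : ℤ) = B.card + delta0 G A := by
  apply le_antisymm
  · obtain ⟨S, hS, hcard⟩ := exists_mem_eq_sup
      ((univ : Finset V).powerset.filter (IsIndep G)) ⟨∅, by simp [IsIndep]⟩ card
    have hS : IsIndep G S := (mem_filter.1 hS).2
    have hn : S ∩ B ⊆ B \ nbr G (S ∩ A) := by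
      intro v hv
      simp only [mem_sdiff, mem_nbr, mem_inter] at hv ⊢
      exact ⟨hv.2, fun ⟨x, hx, hvx⟩ => hS v hv.1 x hx.1 hvx⟩
    have h₁ := card_le_card hn
    have h₂ := card_sdiff_add_card_eq_card (h.nbr_subset (X := S ∩ A) inter_subset_right)
    have h₃ := h.card_inter_add_card_inter S
    have h₄ := diffZ_le_delta0 G (X := S ∩ A) (A := A) inter_subset_right
    rw [indepNum, hcard]
    simp only [diffZ] at h₄
    omega
  · obtain ⟨X, hX, hd⟩ := exists_sideCrit G A
    rw [← hd, ← h.card_union_sdiff_nbr hX]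
    exact_mod_cast (h.isIndep_union_sdiff_nbr hX).card_le_indepNum

theorem IsBipartition.sideCrit_sdiff_nbr (h : IsBipartition G A B) (hX : SideCrit G A X) :
    SideCrit G B (B \ nbr G X) := by
  refine ⟨sdiff_subset, le_antisymm (diffZ_le_delta0 G sdiff_subset) ?_⟩
  have hn : nbr G (B \ nbr G X) ⊆ A \ X := by
    intro v hv
    obtain ⟨y, hy, hvy⟩ := mem_nbr.1 hv
    rw [mem_sdiff, mem_nbr] at hy
    exact mem_sdiff.2 ⟨h.symm.mem_right_of_adj hvy hy.1, fun hvX => hy.2 ⟨v, hvX, hvy.symm⟩⟩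
  have h₁ := card_le_card hn
  have h₂ := card_sdiff_add_card_eq_card hX.1
  have h₃ := card_sdiff_add_card_eq_card (h.nbr_subset hX.1)
  have h₄ := h.indepNum_eq
  have h₅ := h.symm.indepNum_eq
  have h₆ := hX.2
  simp only [diffZ] at h₆ ⊢
  omega

theorem IsBipartition.diademSide_eq (h : IsBipartition G A B) :
    diademSide G B = B \ nbr G (kerSide G A) := by
  ext v
  simp only [diademSide, mem_filter, mem_univ, true_and]
  constructor
  · rintro ⟨Y, hY, hv⟩
    refine mem_sdiff.2 ⟨hY.1 hv, fun hn => ?_⟩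
    obtain ⟨x, hx, hvx⟩ := mem_nbr.1 hn
    have hx' := (mem_filter.1 hx).2 _ (h.symm.sideCrit_sdiff_nbr hY)
    exact (mem_sdiff.1 hx').2 (mem_nbr.2 ⟨v, hv, hvx.symm⟩)
  · exact fun hv => ⟨_, h.sideCrit_sdiff_nbr (sideCrit_kerSide G A), hv⟩

theorem IsBipartition.card_kerSide_add_card_diademSide (h : IsBipartition G A B) :
    (kerSide G A).card + (diademSide G B).card = indepNum G := by
  have hK := sideCrit_kerSide G A
  have h₁ := h.card_union_sdiff_nbr hK.1
  rw [card_union_of_disjoint (h.2.2.1.mono hK.1 sdiff_subset), hK.2, ← h.indepNum_eq,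
    ← h.diademSide_eq] at h₁
  exact_mod_cast h₁

theorem IsBipartition.union_sdiff_nbr_inter_left (h : IsBipartition G A B) (hX : X ⊆ A) :
    (X ∪ (B \ nbr G X)) ∩ A = X := by
  ext v
  have := h.mem_right_iff (v := v)
  have := @hX v
  simp only [mem_inter, mem_union, mem_sdiff]
  tauto

theorem IsBipartition.union_sdiff_nbr_inter_right (h : IsBipartition G A B) (hX : X ⊆ A) :
    (X ∪ (B \ nbr G X)) ∩ B = B \ nbr G X := by
  ext v
  have := h.mem_right_iff (v := v)
  have := @hX v
  simp only [mem_inter, mem_union, mem_sdiff]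
  tauto

theorem IsBipartition.diffZ_union_sdiff_nbr (h : IsBipartition G A B) (hX : SideCrit G A X) :
    diffZ G (X ∪ (B \ nbr G X)) = delta0 G A + delta0 G B := by
  rw [h.diffZ_eq, h.union_sdiff_nbr_inter_left hX.1, h.union_sdiff_nbr_inter_right hX.1, hX.2,
    (h.sideCrit_sdiff_nbr hX).2]

theorem IsBipartition.idc_eq (h : IsBipartition G A B) :
    idc G = delta0 G A + delta0 G B := by
  apply le_antisymm
  · refine sup'_le _ _ fun S _ => ?_
    rw [h.diffZ_eq S]
    exact add_le_add (diffZ_le_delta0 G inter_subset_right) (diffZ_le_delta0 G inter_subset_right)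
  · obtain ⟨X, hX⟩ := exists_sideCrit G A
    rw [← h.diffZ_union_sdiff_nbr hX]
    exact le_sup' (diffZ G) (by simpa using h.isIndep_union_sdiff_nbr hX.1)

theorem IsBipartition.critIndep_union_sdiff_nbr (h : IsBipartition G A B)
    (hX : SideCrit G A X) : CritIndep G (X ∪ (B \ nbr G X)) :=
  ⟨h.isIndep_union_sdiff_nbr hX.1, by rw [h.diffZ_union_sdiff_nbr hX, h.idc_eq]⟩

theorem CritIndep.sideCrit_inter (hS : CritIndep G S) (h : IsBipartition G A B) :
    SideCrit G A (S ∩ A) := by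
  have h₁ := diffZ_le_delta0 G (X := S ∩ A) (A := A) inter_subset_right
  have h₂ := diffZ_le_delta0 G (X := S ∩ B) (A := B) inter_subset_right
  have h₃ := hS.2
  rw [h.diffZ_eq, h.idc_eq] at h₃
  exact ⟨inter_subset_right, by omega⟩

theorem IsBipartition.kerSet_inter (h : IsBipartition G A B) :
    kerSet G ∩ A = kerSide G A := by
  ext v
  simp only [kerSet, kerSide, mem_inter, mem_filter, mem_univ, true_and]
  constructor
  · rintro ⟨hv, hvA⟩ X hX
    rw [← h.union_sdiff_nbr_inter_left hX.1]
    exact mem_inter.2 ⟨hv _ (h.critIndep_union_sdiff_nbr hX), hvA⟩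
  · intro hv
    obtain ⟨X, hX⟩ := exists_sideCrit G A
    exact ⟨fun S hS => (mem_inter.1 (hv _ (hS.sideCrit_inter h))).1, hX.1 (hv X hX)⟩

theorem IsBipartition.diademSet_inter (h : IsBipartition G A B) :
    diademSet G ∩ A = diademSide G A := by
  ext v
  simp only [diademSet, diademSide, mem_inter, mem_filter, mem_univ, true_and]
  constructor
  · rintro ⟨⟨S, hS, hv⟩, hvA⟩
    exact ⟨_, hS.sideCrit_inter h, mem_inter.2 ⟨hv, hvA⟩⟩
  · rintro ⟨X, hX, hv⟩
    exact ⟨⟨_, h.critIndep_union_sdiff_nbr hX, mem_union_left _ hv⟩, hX.1 hv⟩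

end Bipartite

/-- For every finite bipartite graph, `|ker(G)| + |diadem(G)| = 2α(G)`. -/
theorem kerSet_card_add_diademSet_card (G : SimpleGraph V) (A B : Finset V)
    (hbip : IsBipartition G A B) :
    (kerSet G).card + (diademSet G).card = 2 * indepNum G := by
  have h₁ := hbip.card_kerSide_add_card_diademSide
  have h₂ := hbip.symm.card_kerSide_add_card_diademSide
  rw [← hbip.card_inter_add_card_inter (kerSet G), ← hbip.card_inter_add_card_inter (diademSet G),
    hbip.kerSet_inter, hbip.symm.kerSet_inter, hbip.diademSet_inter, hbip.symm.diademSet_inter]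
  omega
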